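/- One has h(18) = 34/9, h(p) < 34/9 for every p ∈ (0, ∞) with p ≠ 18, and h is strictly decreasing on [18, ∞). Consequently, V_p(x) ≤ V_{18}(x) for all x, p ∈ (0, ∞), i.e., the threshold p* = 18 (corresponding to the free-boundary solution U₂(x) = (34/9)x²) is optimal over all threshold stopping times. -/

import Mathlib

open Set Filter

/-- Example 2 payoff: `g(x) = ((x−1)² + 1)·x²` for `x ≤ 2` and
`g(x) = x − 9 + (15/4)·x²` for `x > 2`. -/
noncomputable def gEx (x : ℝ) : ℝ :=
  if x ≤ 2 then ((x - 1) ^ 2 + 1) * x ^ 2 else x - 9 + (15 / 4) * x ^ 2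

/-- Example 2: `h(p) = g(p)/p²` (here `ψ(x) = x²`). -/
noncomputable def hEx (p : ℝ) : ℝ := gEx p / p ^ 2

/-- Example 2 threshold value: `V_p(x) = h(p)·x²` for `x < p`, `g(x)` for `x ≥ p`. -/
noncomputable def VEx (p x : ℝ) : ℝ :=
  if x < p then hEx p * x ^ 2 else gEx x

theorem hEx_of_le_two {p : ℝ} (hp : 0 < p) (hp2 : p ≤ 2) : hEx p = (p - 1) ^ 2 + 1 := by
  have hne : p ≠ 0 := hp.ne'
  rw [hEx, gEx, if_pos hp2]
  field_simp

theorem hEx_of_two_lt {p : ℝ} (hp : 2 < p) :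
    hEx p = 34 / 9 - 9 * (p⁻¹ - 18⁻¹) ^ 2 := by
  have hne : p ≠ 0 := by positivity
  rw [hEx, gEx, if_neg hp.not_ge]
  field_simp
  ring

theorem hEx_eighteen : hEx 18 = 34 / 9 := by
  rw [hEx_of_two_lt (by norm_num)]
  norm_num

theorem hEx_lt_of_ne_eighteen {p : ℝ} (hp : 0 < p) (hne : p ≠ 18) : hEx p < 34 / 9 := by
  rcases le_or_gt p 2 with h | h
  · rw [hEx_of_le_two hp h]
    nlinarith
  · rw [hEx_of_two_lt h]
    have : p⁻¹ - 18⁻¹ ≠ 0 := sub_ne_zero.mpr (inv_injective.ne hne)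
    have := pow_pos (abs_pos.mpr this) 2
    rw [sq_abs] at this
    linarith

theorem hEx_le {p : ℝ} (hp : 0 < p) : hEx p ≤ 34 / 9 := by
  rcases eq_or_ne p 18 with rfl | h
  · exact hEx_eighteen.le
  · exact (hEx_lt_of_ne_eighteen hp h).le

theorem strictAntiOn_hEx : StrictAntiOn hEx (Ici 18) := by
  intro a ha b hb hab
  rw [mem_Ici] at ha hb
  rw [hEx_of_two_lt (by linarith), hEx_of_two_lt (by linarith)]
  have h₁ : b⁻¹ < a⁻¹ := inv_strictAnti₀ (by linarith) hab
  have h₂ : a⁻¹ ≤ 18⁻¹ := inv_anti₀ (by norm_num) ha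
  nlinarith

theorem hEx_mul_sq {x : ℝ} (hx : 0 < x) : hEx x * x ^ 2 = gEx x :=
  div_mul_cancel₀ _ (by positivity)

theorem VEx_le_VEx_eighteen {x p : ℝ} (hx : 0 < x) (hp : 0 < p) : VEx p x ≤ VEx 18 x := by
  unfold VEx
  rw [← hEx_mul_sq hx]
  split_ifs with hxp hx18 hx18
  · exact mul_le_mul_of_nonneg_right (hEx_eighteen ▸ hEx_le hp) (sq_nonneg x)
  · rw [not_lt] at hx18
    exact mul_le_mul_of_nonneg_right
      (strictAntiOn_hEx hx18 (hx18.trans hxp.le) hxp).le (sq_nonneg x)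
  · exact mul_le_mul_of_nonneg_right (hEx_eighteen ▸ hEx_le hx) (sq_nonneg x)
  · exact le_rfl

/-- `h(18) = 34/9`, `h(p) < 34/9` for `0 < p ≠ 18` and `h` is strictly decreasing on
`[18, ∞)`; consequently `V_p(x) ≤ V_{18}(x)` for all `x, p > 0`, i.e. the threshold
`p* = 18` (corresponding to the free-boundary solution `U₂(x) = (34/9)x²`) is optimal
over all threshold stopping times. -/
theorem stmt_16 :
    hEx 18 = 34 / 9 ∧
      (∀ p ∈ Ioi (0 : ℝ), p ≠ 18 → hEx p < 34 / 9) ∧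
      StrictAntiOn hEx (Ici 18) ∧
      ∀ x ∈ Ioi (0 : ℝ), ∀ p ∈ Ioi (0 : ℝ), VEx p x ≤ VEx 18 x :=
  ⟨hEx_eighteen, fun _ hp hne => hEx_lt_of_ne_eighteen hp hne, strictAntiOn_hEx,
    fun _ hx _ hp => VEx_le_VEx_eighteen hx hp⟩
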